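/- Suppose x^n − 1 = h·g in R = F_q[x;θ,Im] with g = g_0 + g_1x + ⋯ + g_rx^r and h monic, and let C ⊆ F_q^n be the (θ,Im)-cyclic code determined by g. Then the n − r vectors T_{θ,Im}^k(g_0, g_1, ..., g_r, 0, ..., 0) for 0 ≤ k ≤ n − r − 1 form a basis of C as a left F_q-vector space; in particular dim_{F_q} C = n − r. -/

import Mathlib

/-- A presentation of the skew polynomial ring `A[x;σ,δ]`: a ring `R` together with an
inclusion of constants `C : A →+* R` and an element `X` satisfying the commutation rule
`X * a = σ(a) * X + δ(a)`, such that every element of `R` is uniquely a left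
`A`-linear combination of the powers of `X`. -/
structure SkewPolyRing (A : Type*) [Ring A] (σ : A →+* A) (δ : A → A)
    (R : Type*) [Ring R] where
  /-- the inclusion of the coefficient ring -/
  C : A →+* R
  /-- the skew variable -/
  X : R
  comm : ∀ a : A, X * C a = C (σ a) * X + C (δ a)
  /-- the (unique) left coefficients of a skew polynomial -/
  coeff : R → (ℕ →₀ A)
  repr_eq : ∀ f : R, f = (coeff f).sum fun i a => C a * X ^ i
  coeff_mk : ∀ c : ℕ →₀ A, coeff (c.sum fun i a => C a * X ^ i) = c

namespace SkewPolyRing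

variable {A : Type*} [Ring A] {σ : A →+* A} {δ : A → A} {R : Type*} [Ring R]

/-- The degree of a nonzero skew polynomial (junk value `0` for the zero polynomial). -/
def deg (P : SkewPolyRing A σ δ R) (f : R) : ℕ := (P.coeff f).support.sup id

/-- `δ` is a `σ`-derivation: it is additive and satisfies the twisted Leibniz rule. -/
def IsDerivation (σ : A →+* A) (δ : A → A) : Prop :=
  (∀ a b : A, δ (a + b) = δ a + δ b) ∧ ∀ a b : A, δ (a * b) = δ a * b + σ a * δ b

end SkewPolyRing


namespace SkewPolyRing

variable {A : Type*} [Ring A] {σ : A →+* A} {δ : A → A} {R : Type*} [Ring R]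

/-- A skew polynomial is monic if its leading coefficient is `1`. -/
def Monic (P : SkewPolyRing A σ δ R) (f : R) : Prop := P.coeff f (P.deg f) = 1

/-- The `(σ,δ)`-cyclic code of length `n` determined by a right divisor `g` of `xⁿ - 1`:
the set of coefficient vectors, in the basis `{1, x, …, x^{n-1}}`, of the elements of the
left module `Rg/R(xⁿ-1)` viewed inside `R/R(xⁿ-1)`. -/
def codeOf (P : SkewPolyRing A σ δ R) (n : ℕ) (g : R) : Set (Fin n → A) :=
  {c | ∃ a b : R, (∑ i : Fin n, P.C (c i) * P.X ^ (i : ℕ)) = a * g + b * (P.X ^ n - 1)}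

end SkewPolyRing

/-- The pseudo-linear transformation `T_{σ,δ}(v) = σ(v)·M + δ(v)`, where `σ, δ` act
coordinatewise and `M` is the cyclic-shift matrix. -/
def pseudoT {S : Type*} [Ring S] (σ : S → S) (δ : S → S) (n : ℕ) [NeZero n]
    (v : Fin n → S) : Fin n → S :=
  fun i => σ (v (i - 1)) + δ (v i)

namespace SkewPolyRing

variable {A : Type*} [Ring A] {σ : A →+* A} {δ : A → A} {R : Type*} [Ring R]

theorem coeff_monomial (P : SkewPolyRing A σ δ R) (a : A) (k : ℕ) :
    P.coeff (P.C a * P.X ^ k) = Finsupp.single k a := by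
  have h := P.coeff_mk (Finsupp.single k a)
  rwa [Finsupp.sum_single_index (by simp)] at h

theorem coeff_add (P : SkewPolyRing A σ δ R) (f g : R) :
    P.coeff (f + g) = P.coeff f + P.coeff g := by
  have h := P.coeff_mk (P.coeff f + P.coeff g)
  rwa [Finsupp.sum_add_index' (by simp) (by simp [add_mul]), ← P.repr_eq, ← P.repr_eq] at h

/-- The `i`-th left coefficient, as an additive map. -/
def coeffHom (P : SkewPolyRing A σ δ R) (i : ℕ) : R →+ A :=
  AddMonoidHom.mk' (fun f => P.coeff f i) fun f g => by rw [coeff_add, Finsupp.add_apply]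

@[simp]
theorem coeffHom_apply (P : SkewPolyRing A σ δ R) (i : ℕ) (f : R) :
    P.coeffHom i f = P.coeff f i := rfl

theorem coeff_injective (P : SkewPolyRing A σ δ R) : Function.Injective P.coeff := fun f g h => by
  rw [P.repr_eq f, h, ← P.repr_eq]

theorem coeff_sum_apply (P : SkewPolyRing A σ δ R) {ι : Type*} (s : Finset ι) (f : ι → R)
    (i : ℕ) : P.coeff (∑ k ∈ s, f k) i = ∑ k ∈ s, P.coeff (f k) i :=
  map_sum (P.coeffHom i) f s

theorem induction_on (P : SkewPolyRing A σ δ R) {p : R → Prop} (f : R)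
    (add : ∀ f g, p f → p g → p (f + g)) (monomial : ∀ a k, p (P.C a * P.X ^ k)) : p f := by
  rw [P.repr_eq f]
  exact Finset.sum_induction _ p add (by simpa using monomial 0 0) fun k _ => monomial _ k

theorem coeff_C_mul (P : SkewPolyRing A σ δ R) (a : A) (f : R) (i : ℕ) :
    P.coeff (P.C a * f) i = a * P.coeff f i := by
  induction f using P.induction_on with
  | add f g hf hg => simp only [mul_add, coeff_add, Finsupp.add_apply, hf, hg]
  | monomial b k =>
    rw [← mul_assoc, ← map_mul, coeff_monomial, coeff_monomial]
    simp only [Finsupp.single_apply, mul_ite, mul_zero]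

theorem IsDerivation.map_zero (hδ : IsDerivation σ δ) : δ 0 = 0 := by
  simpa using hδ.1 0 0

theorem coeff_X_mul_monomial (P : SkewPolyRing A σ δ R) (a : A) (k : ℕ) :
    P.coeff (P.X * (P.C a * P.X ^ k)) = Finsupp.single (k + 1) (σ a) + Finsupp.single k (δ a) := by
  rw [← mul_assoc, P.comm, add_mul, mul_assoc, ← pow_succ', coeff_add, coeff_monomial,
    coeff_monomial]

theorem coeff_X_mul_zero (P : SkewPolyRing A σ δ R) (hδ : IsDerivation σ δ) (f : R) :
    P.coeff (P.X * f) 0 = δ (P.coeff f 0) := by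
  induction f using P.induction_on with
  | add f g hf hg => simp only [mul_add, coeff_add, Finsupp.add_apply, hf, hg, hδ.1]
  | monomial a k =>
    rw [coeff_X_mul_monomial, coeff_monomial]
    simp [Finsupp.single_apply, apply_ite δ, hδ.map_zero]

theorem coeff_X_mul_succ (P : SkewPolyRing A σ δ R) (hδ : IsDerivation σ δ) (f : R) (i : ℕ) :
    P.coeff (P.X * f) (i + 1) = σ (P.coeff f i) + δ (P.coeff f (i + 1)) := by
  induction f using P.induction_on with
  | add f g hf hg =>
    simp only [mul_add, coeff_add, Finsupp.add_apply, hf, hg, hδ.1, map_add]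
    abel
  | monomial a k =>
    rw [coeff_X_mul_monomial, coeff_monomial]
    simp [Finsupp.single_apply, apply_ite δ, apply_ite σ, hδ.map_zero]

theorem coeff_eq_zero_of_deg_lt (P : SkewPolyRing A σ δ R) {f : R} {i : ℕ} (h : P.deg f < i) :
    P.coeff f i = 0 := by
  by_contra hi
  exact absurd (Finset.le_sup (f := id) (Finsupp.mem_support_iff.2 hi)) (not_le.2 h)

theorem coeff_deg_ne_zero (P : SkewPolyRing A σ δ R) {f : R} (h : f ≠ 0) :
    P.coeff f (P.deg f) ≠ 0 := by
  have hne : (P.coeff f).support.Nonempty := by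
    rw [Finsupp.support_nonempty_iff]
    intro h0
    apply h
    rw [P.repr_eq f, h0, Finsupp.sum_zero_index]
  obtain ⟨i, hi, hie⟩ := Finset.exists_mem_eq_sup _ hne (id : ℕ → ℕ)
  rw [deg, hie]
  exact Finsupp.mem_support_iff.1 hi

theorem coeff_X_pow_mul_of_deg_lt (P : SkewPolyRing A σ δ R) (hδ : IsDerivation σ δ) (g : R)
    (k : ℕ) : ∀ {i : ℕ}, P.deg g + k < i → P.coeff (P.X ^ k * g) i = 0 := by
  induction k with
  | zero => intro i hi; simpa using P.coeff_eq_zero_of_deg_lt hi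
  | succ k ih =>
    intro i hi
    obtain ⟨j, rfl⟩ : ∃ j, i = j + 1 := ⟨i - 1, by omega⟩
    rw [pow_succ', mul_assoc, P.coeff_X_mul_succ hδ, ih (by omega), ih (by omega), map_zero,
      hδ.map_zero, add_zero]

theorem Monic.coeff_X_pow_mul {P : SkewPolyRing A σ δ R} {g : R} (hg : P.Monic g)
    (hδ : IsDerivation σ δ) (k : ℕ) : P.coeff (P.X ^ k * g) (P.deg g + k) = 1 := by
  induction k with
  | zero => rwa [pow_zero, one_mul, add_zero]
  | succ k ih =>
    rw [pow_succ', mul_assoc, ← add_assoc, P.coeff_X_mul_succ hδ, ih,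
      P.coeff_X_pow_mul_of_deg_lt hδ g k (by omega), map_one, hδ.map_zero, add_zero]

theorem coeff_mul (P : SkewPolyRing A σ δ R) (f g : R) {m : ℕ}
    (hm : ∀ k, m ≤ k → P.coeff f k = 0) (i : ℕ) :
    P.coeff (f * g) i = ∑ k ∈ Finset.range m, P.coeff f k * P.coeff (P.X ^ k * g) i := by
  conv_lhs => rw [P.repr_eq f]
  rw [Finsupp.sum_of_support_subset (s := Finset.range m) _ _ _ (by simp), Finset.sum_mul,
    coeff_sum_apply]
  · simp only [mul_assoc, coeff_C_mul]
  · intro k hk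
    by_contra hkm
    exact Finsupp.mem_support_iff.1 hk (hm k (by simpa using hkm))

/-- Multiplying on the right by a monic skew polynomial of degree `r` raises the degree by `r`. -/
theorem Monic.coeff_mul_deg_add_deg {P : SkewPolyRing A σ δ R} {g : R} (hg : P.Monic g)
    (hδ : IsDerivation σ δ) (f : R) :
    P.coeff (f * g) (P.deg g + P.deg f) = P.coeff f (P.deg f) := by
  rw [P.coeff_mul f g (m := P.deg f + 1) fun k hk => P.coeff_eq_zero_of_deg_lt hk,
    Finset.sum_range_succ, hg.coeff_X_pow_mul hδ, mul_one, Finset.sum_eq_zero, zero_add]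
  intro k hk
  rw [P.coeff_X_pow_mul_of_deg_lt hδ g k (by have := Finset.mem_range.1 hk; omega), mul_zero]

theorem Monic.coeff_eq_zero_of_coeff_mul_eq_zero {P : SkewPolyRing A σ δ R} {g : R}
    (hg : P.Monic g) (hδ : IsDerivation σ δ) {f : R} {n : ℕ}
    (hf : ∀ i, n ≤ i → P.coeff (f * g) i = 0) {k : ℕ} (hk : n - P.deg g ≤ k) :
    P.coeff f k = 0 := by
  by_contra hne
  have hf0 : f ≠ 0 := by
    rintro rfl
    exact hne (map_zero (P.coeffHom k))
  have hkd : k ≤ P.deg f := not_lt.1 fun h => hne (P.coeff_eq_zero_of_deg_lt h)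
  refine P.coeff_deg_ne_zero hf0 ?_
  rw [← hg.coeff_mul_deg_add_deg hδ, hf _ (by omega)]

theorem coeff_sum_fin (P : SkewPolyRing A σ δ R) {n : ℕ} (c : Fin n → A) (i : ℕ) :
    P.coeff (∑ k : Fin n, P.C (c k) * P.X ^ (k : ℕ)) i = if h : i < n then c ⟨i, h⟩ else 0 := by
  simp only [coeff_sum_apply, coeff_monomial, Finsupp.single_apply]
  split_ifs with h
  · rw [Finset.sum_eq_single ⟨i, h⟩] <;> simp +contextual [Fin.ext_iff]
  · exact Finset.sum_eq_zero fun k _ => if_neg (by omega)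

theorem coeff_sum_fin_mul (P : SkewPolyRing A σ δ R) {n : ℕ} (c : Fin n → A) (g : R) (i : ℕ) :
    P.coeff ((∑ k : Fin n, P.C (c k) * P.X ^ (k : ℕ)) * g) i =
      ∑ k : Fin n, c k * P.coeff (P.X ^ (k : ℕ) * g) i := by
  simp only [Finset.sum_mul, coeff_sum_apply, mul_assoc, coeff_C_mul]

/-- As long as no wrap-around occurs, iterating `pseudoT` is left multiplication by powers
of `X`. -/
theorem pseudoT_iterate_apply (P : SkewPolyRing A σ δ R) (hδ : IsDerivation σ δ) {n : ℕ}
    [NeZero n] (g : R) (k : ℕ) (hk : P.deg g + k < n) :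
    (pseudoT σ δ n)^[k] (fun i => P.coeff g (i : ℕ)) =
      fun i : Fin n => P.coeff (P.X ^ k * g) (i : ℕ) := by
  induction k with
  | zero => simp
  | succ k ih =>
    rw [Function.iterate_succ_apply', ih (by omega)]
    funext ⟨i, hi⟩
    obtain ⟨m, rfl⟩ : ∃ m, n = m + 1 := ⟨n - 1, by omega⟩
    rw [pow_succ', mul_assoc]
    simp only [pseudoT]
    rcases i with _ | i
    · have hw : (((⟨0, hi⟩ : Fin (m + 1)) - 1 : Fin (m + 1)) : ℕ) = m := by
        simp
      rw [hw, P.coeff_X_mul_zero hδ, P.coeff_X_pow_mul_of_deg_lt hδ g k (by omega), map_zero,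
        zero_add]
    · have hw : (((⟨i + 1, hi⟩ : Fin (m + 1)) - 1 : Fin (m + 1)) : ℕ) = i := by
        simp [Fin.coe_sub_one, Fin.ext_iff]
      rw [hw, P.coeff_X_mul_succ hδ]

theorem mem_codeOf_iff (P : SkewPolyRing A σ δ R) {n : ℕ} {g h : R}
    (hfac : P.X ^ n - 1 = h * g) {c : Fin n → A} :
    c ∈ P.codeOf n g ↔ ∃ f : R, ∑ i : Fin n, P.C (c i) * P.X ^ (i : ℕ) = f * g := by
  constructor
  · rintro ⟨a, b, hab⟩
    exact ⟨a + b * h, by rw [hab, hfac, add_mul, mul_assoc]⟩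
  · rintro ⟨f, hf⟩
    exact ⟨f, 0, by rw [hf, zero_mul, add_zero]⟩

end SkewPolyRing

/-- The vectors `T_{θ,Im}^k(g₀, …, g_r, 0, …, 0)`, `0 ≤ k ≤ n - r - 1`, form a basis of the
`(θ,Im)`-cyclic code determined by `g` as a left `F_q`-vector space; in particular the code
has dimension `n - r`. -/
theorem code_basis_pseudoT_iterates {F R : Type*} [Field F] [Fintype F] [Ring R]
    (θ : F ≃+* F) (Im : F → F) (hIm : SkewPolyRing.IsDerivation (θ : F →+* F) Im)
    (P : SkewPolyRing F (θ : F →+* F) Im R) (n : ℕ) [NeZero n] (g h : R) (r : ℕ)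
    (hg : P.Monic g) (hh : P.Monic h) (hr : P.deg g = r)
    (hfac : P.X ^ n - 1 = h * g) :
    let gv : Fin n → F := fun i => P.coeff g (i : ℕ)
    let w : Fin (n - r) → Fin n → F := fun k => (pseudoT (⇑θ) Im n)^[(k : ℕ)] gv
    LinearIndependent F w ∧
      (Submodule.span F (Set.range w) : Set (Fin n → F)) = P.codeOf n g ∧
      Module.finrank F (Submodule.span F (Set.range w)) = n - r := by
  intro gv w
  have hw : ∀ (k : Fin (n - r)) (i : Fin n), w k i = P.coeff (P.X ^ (k : ℕ) * g) (i : ℕ) :=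
    fun k i => congrFun (P.pseudoT_iterate_apply hIm g (k : ℕ) (by omega)) i
  have hcomb : ∀ (a : Fin (n - r) → F) (i : Fin n), (∑ k, a k • w k) i =
      P.coeff ((∑ k, P.C (a k) * P.X ^ (k : ℕ)) * g) (i : ℕ) := fun a i => by
    simp only [P.coeff_sum_fin_mul, Finset.sum_apply, Pi.smul_apply, smul_eq_mul, hw]
  have hhigh : ∀ (a : Fin (n - r) → F) (i : ℕ), n ≤ i →
      P.coeff ((∑ k, P.C (a k) * P.X ^ (k : ℕ)) * g) i = 0 := fun a i hi => by
    rw [P.coeff_sum_fin_mul]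
    exact Finset.sum_eq_zero fun k _ => by
      rw [P.coeff_X_pow_mul_of_deg_lt hIm g k (by omega), mul_zero]
  have hli : LinearIndependent F w := by
    rw [Fintype.linearIndependent_iff]
    intro a ha k
    have hz := hg.coeff_eq_zero_of_coeff_mul_eq_zero hIm (n := 0)
      (f := ∑ k, P.C (a k) * P.X ^ (k : ℕ)) (fun i _ => by
        by_cases hi : i < n
        · rw [← hcomb a ⟨i, hi⟩, ha, Pi.zero_apply]
        · exact hhigh a i (not_lt.1 hi)) (k := k) (by omega)
    simpa [P.coeff_sum_fin] using hz
  refine ⟨hli, ?_, by rw [finrank_span_eq_card hli, Fintype.card_fin]⟩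
  ext c
  rw [SetLike.mem_coe, P.mem_codeOf_iff hfac, Submodule.mem_span_range_iff_exists_fun]
  constructor
  · rintro ⟨a, rfl⟩
    refine ⟨∑ k, P.C (a k) * P.X ^ (k : ℕ), P.coeff_injective (Finsupp.ext fun i => ?_)⟩
    rw [P.coeff_sum_fin]
    split_ifs with hi
    · exact hcomb a ⟨i, hi⟩
    · exact (hhigh a i (not_lt.1 hi)).symm
  · rintro ⟨f, hf⟩
    have hzero : ∀ k, n - r ≤ k → P.coeff f k = 0 := fun k hk =>
      hg.coeff_eq_zero_of_coeff_mul_eq_zero hIm (n := n)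
        (fun i hi => by rw [← hf, P.coeff_sum_fin, dif_neg (not_lt.2 hi)]) (hr ▸ hk)
    refine ⟨fun k => P.coeff f k, funext fun i => ?_⟩
    have hc : P.coeff (f * g) (i : ℕ) = c i := by
      rw [← hf, P.coeff_sum_fin, dif_pos i.2]
    rw [← hc, P.coeff_mul f g hzero, Finset.sum_range]
    simp only [Finset.sum_apply, Pi.smul_apply, smul_eq_mul, hw]
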